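/- Let G be a function defined on integers k ≥ m with values in (0,1), strictly decreasing to 0, such that G(k+1)/G(k) → 0 as k → ∞. With A_ρ := G_c^{-1}(1/ρ) and I_ρ := ⌊A_ρ + 1/2⌋, the function ρ ↦ ρ · G_c(I_ρ) does not converge as ρ → ∞: its inferior limit equals 0 and its superior limit equals +∞. -/

import Mathlib

open Filter Real

/-- Piecewise linear interpolation of a sequence. -/
noncomputable def linearInterp (u : ℕ → ℝ) (x : ℝ) : ℝ :=
  u ⌊x⌋₊ + (x - (⌊x⌋₊ : ℝ)) * (u (⌊x⌋₊ + 1) - u ⌊x⌋₊)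

theorem linearInterp_natCast_add (u : ℕ → ℝ) (n : ℕ) {t : ℝ} (h0 : 0 ≤ t) (h1 : t < 1) :
    linearInterp u (n + t) = u n + t * (u (n + 1) - u n) := by
  have hf : ⌊(n : ℝ) + t⌋₊ = n := by
    rw [Nat.floor_eq_iff (by positivity)]
    constructor <;> linarith
  simp [linearInterp, hf]

theorem linearInterp_natCast (u : ℕ → ℝ) (n : ℕ) : linearInterp u n = u n := by
  simp [linearInterp]

theorem strictAntiOn_linearInterp {m : ℕ} {u : ℕ → ℝ} (hu : ∀ k, m ≤ k → u (k + 1) < u k) :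
    StrictAntiOn (linearInterp u) (Set.Ici (m : ℝ)) := by
  have hanti : ∀ a b, m ≤ a → a ≤ b → u b ≤ u a := by
    intro a b ha hab
    induction b, hab using Nat.le_induction with
    | base => exact le_rfl
    | succ b hab ih => exact (hu b (ha.trans hab)).le.trans ih
  intro x hx y hy hxy
  rw [Set.mem_Ici] at hx hy
  have hx0 : 0 ≤ x := (Nat.cast_nonneg m).trans hx
  have hy0 : 0 ≤ y := (Nat.cast_nonneg m).trans hy
  have hmx : m ≤ ⌊x⌋₊ := Nat.le_floor hx
  have hmy : m ≤ ⌊y⌋₊ := Nat.le_floor hy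
  have hdx := hu _ hmx
  have hdy := hu _ hmy
  have hx1 := Nat.lt_floor_add_one x
  have hy1 := Nat.floor_le hy0
  unfold linearInterp
  rcases (Nat.floor_mono hxy.le).eq_or_lt with h | h
  · rw [← h]
    nlinarith
  · have := hanti (⌊x⌋₊ + 1) ⌊y⌋₊ (by omega) h
    nlinarith

/-- If `A` inverts `ρ ↦ 1 / ρ` through the exponential of an interpolated sequence, then there are
arbitrarily large `ρ` with `A ρ` of fractional part `t`, and `ρ` is then explicit. -/
theorem frequently_of_eventually_natCast_add {m : ℕ} {u : ℕ → ℝ}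
    (hu : ∀ k, m ≤ k → u (k + 1) < u k) (hlim : Tendsto u atTop atBot) {A : ℝ → ℝ}
    (hA : ∀ᶠ ρ : ℝ in atTop, (m : ℝ) ≤ A ρ ∧ exp (linearInterp u (A ρ)) = 1 / ρ)
    {t : ℝ} (h0 : 0 ≤ t) (h1 : t < 1) {P : ℝ → ℝ → Prop}
    (hP : ∀ᶠ n : ℕ in atTop, P (exp (-(u n + t * (u (n + 1) - u n)))) (n + t)) :
    ∃ᶠ ρ : ℝ in atTop, P ρ (A ρ) := by
  have hT : Tendsto (fun n : ℕ => exp (-(u n + t * (u (n + 1) - u n)))) atTop atTop := by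
    refine tendsto_exp_atTop.comp (tendsto_neg_atBot_atTop.comp ?_)
    refine tendsto_atBot_mono' _ ?_ hlim
    filter_upwards [eventually_ge_atTop m] with n hn
    nlinarith [hu n hn]
  refine hT.frequently (Eventually.frequently ?_)
  filter_upwards [hP, hT.eventually hA, eventually_ge_atTop m] with n hn hAn hmn
  have hmn' : (m : ℝ) ≤ n := by exact_mod_cast hmn
  suffices A (exp (-(u n + t * (u (n + 1) - u n)))) = n + t by rwa [this]
  refine (strictAntiOn_linearInterp hu).injOn hAn.1 (Set.mem_Ici.2 (by linarith)) ?_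
  rw [linearInterp_natCast_add u n h0 h1]
  apply exp_injective
  rw [hAn.2, exp_neg, one_div, inv_inv]

/-- Claim stated after Lemma 3.2: with `A ρ = G_c⁻¹(1/ρ)` and `I ρ = ⌊A ρ + 1/2⌋`, the
function `ρ ↦ ρ · G_c(I_ρ)` does not converge as `ρ → ∞`: it is (eventually) positive,
its inferior limit is `0` (it is frequently below any `ε > 0`) and its superior limit is
`+∞` (it is frequently above any `M`). -/
theorem rho_Gc_I_liminf_limsup
    (m : ℕ) (G : ℕ → ℝ)
    (hG01 : ∀ k, m ≤ k → G k ∈ Set.Ioo (0 : ℝ) 1)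
    (hGdec : ∀ k, m ≤ k → G (k + 1) < G k)
    (hGlim : Tendsto G atTop (nhds 0))
    (hratio : Tendsto (fun k : ℕ => G (k + 1) / G k) atTop (nhds 0))
    (Gc : ℝ → ℝ)
    (hGc : ∀ x : ℝ, (m : ℝ) ≤ x → Gc x =
      Real.exp (Real.log (G ⌊x⌋₊) +
        (x - (⌊x⌋₊ : ℝ)) * (Real.log (G (⌊x⌋₊ + 1)) - Real.log (G ⌊x⌋₊))))
    (A : ℝ → ℝ)
    (hA : ∀ᶠ ρ : ℝ in atTop, (m : ℝ) ≤ A ρ ∧ Gc (A ρ) = 1 / ρ) :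
    (∀ᶠ ρ : ℝ in atTop, 0 < ρ * Gc (⌊A ρ + 1 / 2⌋₊ : ℝ)) ∧
    (∀ ε : ℝ, 0 < ε → ∃ᶠ ρ : ℝ in atTop, ρ * Gc (⌊A ρ + 1 / 2⌋₊ : ℝ) < ε) ∧
    (∀ M : ℝ, ∃ᶠ ρ : ℝ in atTop, M < ρ * Gc (⌊A ρ + 1 / 2⌋₊ : ℝ)) := by
  have hpos : ∀ k, m ≤ k → 0 < G k := fun k hk => (hG01 k hk).1
  set u : ℕ → ℝ := fun k => log (G k)
  replace hGc : ∀ x : ℝ, (m : ℝ) ≤ x → Gc x = exp (linearInterp u x) := hGc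
  have hGcn : ∀ k : ℕ, m ≤ k → Gc k = exp (u k) := fun k hk => by
    rw [hGc k (by exact_mod_cast hk), linearInterp_natCast]
  have hu : ∀ k, m ≤ k → u (k + 1) < u k := fun k hk =>
    log_lt_log (hpos _ (by omega)) (hGdec k hk)
  have hlim : Tendsto u atTop atBot := by
    refine tendsto_log_nhdsGT_zero.comp (tendsto_nhdsWithin_iff.2 ⟨hGlim, ?_⟩)
    filter_upwards [eventually_ge_atTop m] with k hk using hpos k hk
  have hdiff : Tendsto (fun k => u (k + 1) - u k) atTop atBot := by
    have h : Tendsto (fun k => log (G (k + 1) / G k)) atTop atBot := by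
      refine tendsto_log_nhdsGT_zero.comp (tendsto_nhdsWithin_iff.2 ⟨hratio, ?_⟩)
      filter_upwards [eventually_ge_atTop m] with k hk
        using div_pos (hpos _ (by omega)) (hpos k hk)
    refine h.congr' ?_
    filter_upwards [eventually_ge_atTop m] with k hk
    exact log_div (hpos _ (by omega)).ne' (hpos k hk).ne'
  have hA' : ∀ᶠ ρ : ℝ in atTop, (m : ℝ) ≤ A ρ ∧ exp (linearInterp u (A ρ)) = 1 / ρ := by
    filter_upwards [hA] with ρ hρ
    exact ⟨hρ.1, by rw [← hGc _ hρ.1, hρ.2]⟩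
  refine ⟨?_, fun ε hε => ?_, fun M => ?_⟩
  · filter_upwards [hA, eventually_gt_atTop 0] with ρ hρ hρ0
    rw [hGcn _ (Nat.le_floor (by linarith [hρ.1]))]
    positivity
  · refine frequently_of_eventually_natCast_add (t := 1 / 2)
      (P := fun ρ a => ρ * Gc (⌊a + 1 / 2⌋₊ : ℝ) < ε) hu hlim hA' (by norm_num) (by norm_num) ?_
    have hT : Tendsto (fun k => exp (1 / 2 * (u (k + 1) - u k))) atTop (nhds 0) :=
      tendsto_exp_atBot.comp (hdiff.const_mul_atBot (by norm_num))
    filter_upwards [hT.eventually_lt_const hε, eventually_ge_atTop m] with n hn hmn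
    have hf : ⌊(n : ℝ) + 1 / 2 + 1 / 2⌋₊ = n + 1 := by
      rw [Nat.floor_eq_iff (by positivity)]
      push_cast
      constructor <;> linarith
    rw [hf, hGcn _ (by omega), ← exp_add]
    refine (congrArg exp ?_).trans_lt hn
    ring
  · refine frequently_of_eventually_natCast_add (t := 1 / 4)
      (P := fun ρ a => M < ρ * Gc (⌊a + 1 / 2⌋₊ : ℝ)) hu hlim hA' (by norm_num) (by norm_num) ?_
    have hT : Tendsto (fun k => exp (-(1 / 4) * (u (k + 1) - u k))) atTop atTop :=
      tendsto_exp_atTop.comp (hdiff.const_mul_atBot_of_neg (by norm_num))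
    filter_upwards [hT.eventually_gt_atTop M, eventually_ge_atTop m] with n hn hmn
    have hf : ⌊(n : ℝ) + 1 / 4 + 1 / 2⌋₊ = n := by
      rw [Nat.floor_eq_iff (by positivity)]
      constructor <;> linarith
    rw [hf, hGcn _ hmn, ← exp_add]
    refine hn.trans_eq (congrArg exp ?_)
    ring
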